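/- arXiv:1312.6332 — 4 statements merged into one kernel-verified Lean document; each statement's English description precedes it below -/
import Mathlib

section
/- For v ∈ ℕ with v ≥ 1, define F(v) = Σ_{n ≥ 1, 2n² ≤ v} G(v, n), where G(v, n) = Σ_r ∏_j binom(12v, r_j), the inner sum being over all finitely supported functions r from the odd positive integers to ℕ∪{0} satisfying 2·Σ_j j·r_j = v − 2n² (this inner sum is empty, hence 0, if v − 2n² is odd), and the product being over the odd j in the support of r (empty product = 1). Then F(v) is odd if and only if v = 2^β for some odd β ∈ ℕ. -/
/-- `G(v,n) = Σ_r ∏_j binom(12v, r_j)`, the sum being over all finitely supported functions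
`r` from the odd positive integers to `ℕ` with `2·Σ_j j·r_j = v − 2n²` (an empty sum is `0`),
and the product over the odd `j` in the support of `r`. -/
noncomputable def Gsum (v n : ℕ) : ℕ :=
  ∑ᶠ r ∈ {r : ℕ →₀ ℕ | (∀ j ∈ r.support, Odd j) ∧
      2 * ((r.sum fun j k => j * k : ℕ) : ℤ) = (v : ℤ) - 2 * (n : ℤ) ^ 2},
    ∏ j ∈ r.support, (12 * v).choose (r j)

/-- `F(v) = Σ_{n ≥ 1, 2n² ≤ v} G(v,n)`. -/
noncomputable def Fsum (v : ℕ) : ℕ :=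
  ∑ᶠ n ∈ {n : ℕ | 1 ≤ n ∧ 2 * n ^ 2 ≤ v}, Gsum v n

section FiniteGauss

variable {R : Type*} [CommRing R]

/-- Shanks' finite form of Gauss's identity
`∑ q ^ (t (t + 1) / 2) = ∏ (1 - q ^ (2 j)) / (1 - q ^ (2 j - 1))`. -/
theorem shanks_sum_eq (q : R) (u : ℕ → R) (hu : ∀ j, u j * (1 - q ^ (2 * j + 1)) = 1) (n : ℕ) :
    ∑ s ∈ Finset.range (n + 1),
        (∏ j ∈ Finset.Ico s n, (1 - q ^ (2 * j + 2)) * u j) * q ^ (s * (2 * n + 1)) =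
      ∑ t ∈ Finset.range (2 * n + 1), q ^ (t * (t + 1) / 2) := by
  induction n with
  | zero => simp
  | succ n ih =>
    have e1 : (2 * n + 1) * (2 * n + 1 + 1) / 2 = (2 * n + 1) * (n + 1) := by
      rw [show (2 * n + 1) * (2 * n + 1 + 1) = (2 * n + 1) * (n + 1) * 2 by ring]; simp
    have e2 : (2 * n + 1 + 1) * (2 * n + 1 + 1 + 1) / 2 = (n + 1) * (2 * (n + 1) + 1) := by
      rw [show (2 * n + 1 + 1) * (2 * n + 1 + 1 + 1) = (n + 1) * (2 * (n + 1) + 1) * 2 by ring]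
      simp
    rw [show 2 * (n + 1) + 1 = 2 * n + 1 + 1 + 1 by ring, Finset.sum_range_succ (n := 2 * n + 1 + 1),
      Finset.sum_range_succ (n := 2 * n + 1), ← ih, e1, e2, Finset.sum_range_succ (n := n + 1)]
    simp only [Finset.Ico_self, Finset.prod_empty, one_mul]
    congr 1
    have telescope : ∀ m ≤ n + 1,
        ∑ s ∈ Finset.range m,
          ((∏ j ∈ Finset.Ico s (n + 1), (1 - q ^ (2 * j + 2)) * u j) *
              q ^ (s * (2 * n + 1 + 1 + 1)) -
            (∏ j ∈ Finset.Ico s n, (1 - q ^ (2 * j + 2)) * u j) * q ^ (s * (2 * n + 1))) =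
        if m = 0 then 0 else
          u n * (∏ j ∈ Finset.Ico (m - 1) n, (1 - q ^ (2 * j + 2)) * u j) *
            q ^ (m * (2 * n + 1)) * (1 - q ^ (2 * (m - 1) + 1)) := by
      intro m
      induction m with
      | zero => simp
      | succ m ihm =>
        intro hm
        rw [Finset.sum_range_succ, ihm (by omega), Finset.prod_Ico_succ_top (by omega)]
        simp only [Nat.add_eq_zero_iff, one_ne_zero, and_false, if_false, Nat.add_sub_cancel]
        rcases m with _ | m
        · simp only [if_true]
          linear_combination (∏ j ∈ Finset.Ico 0 n, (1 - q ^ (2 * j + 2)) * u j) * hu n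
        · simp only [Nat.add_eq_zero_iff, one_ne_zero, and_false, if_false, Nat.add_sub_cancel]
          rw [Finset.prod_eq_prod_Ico_succ_bot (a := m) (by omega)]
          generalize ∏ j ∈ Finset.Ico (m + 1) n, (1 - q ^ (2 * j + 2)) * u j = p
          linear_combination (u n * p * q ^ ((m + 1) * (2 * n + 1)) * (1 - q ^ (2 * m + 2))) * hu m
            + p * q ^ ((m + 1) * (2 * n + 1)) * hu n
    have h := telescope (n + 1) le_rfl
    rw [Finset.sum_sub_distrib] at h
    simp only [Nat.add_eq_zero_iff, one_ne_zero, and_false, if_false, Nat.add_sub_cancel,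
      Finset.Ico_self, Finset.prod_empty, mul_one] at h
    linear_combination h + q ^ ((n + 1) * (2 * n + 1)) * hu n

/-- Modulo `2` and `q ^ (n + 1)`, Gauss's triangular series is inverse to the cube of
`∏ (1 + q ^ (2 j + 1))`. -/
theorem triangular_sum_mul_prod_odd_cube [CharP R 2] (q : R) (n : ℕ) (hq : q ^ (n + 1) = 0) :
    (∑ t ∈ Finset.range (2 * n + 1), q ^ (t * (t + 1) / 2)) *
      (∏ j ∈ Finset.range n, (1 + q ^ (2 * j + 1))) ^ 3 = 1 := by
  have hnil : ∀ k, k ≠ 0 → IsUnit (1 + q ^ k) := fun k hk =>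
    (IsNilpotent.pow_of_pos ⟨n + 1, hq⟩ hk).isUnit_one_add
  choose u hu using fun j : ℕ => (hnil (2 * j + 1) (by omega)).exists_left_inv
  set P := ∏ j ∈ Finset.range n, (1 + q ^ (2 * j + 1)) with hP
  set E := ∏ j ∈ Finset.range n, (1 + q ^ (j + 1)) with hE
  have hsq : ∏ j ∈ Finset.range n, (1 + q ^ (2 * j + 2)) = E ^ 2 := by
    rw [hE, ← Finset.prod_pow]
    refine Finset.prod_congr rfl fun j _ => ?_
    rw [CharTwo.add_sq]; ring
  have hsplit : ∀ m, ∏ j ∈ Finset.range (2 * m), (1 + q ^ (j + 1)) =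
      (∏ j ∈ Finset.range m, (1 + q ^ (2 * j + 1))) *
        ∏ j ∈ Finset.range m, (1 + q ^ (2 * j + 2)) := by
    intro m
    induction m with
    | zero => simp
    | succ m ih =>
      rw [show 2 * (m + 1) = 2 * m + 1 + 1 by ring, Finset.prod_range_succ, Finset.prod_range_succ,
        ih, Finset.prod_range_succ, Finset.prod_range_succ]
      ring
  have htrunc : ∏ j ∈ Finset.range (2 * n), (1 + q ^ (j + 1)) = E := by
    rw [two_mul, Finset.prod_range_add, ← hE, Finset.prod_eq_one, mul_one]
    intro j _
    rw [show n + j + 1 = n + 1 + j by ring, pow_add, hq]; simp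
  have hEu : IsUnit E := by
    rw [hE, IsUnit.prod_iff]
    exact fun j _ => hnil _ (by omega)
  have hPE : P * E = 1 := by
    apply hEu.mul_left_cancel
    linear_combination htrunc - hsplit n - P * hsq
  have hshanks := shanks_sum_eq q u (fun j => by rw [CharTwo.sub_eq_add]; exact hu j) n
  rw [Finset.sum_range_succ', Finset.sum_eq_zero, zero_add, zero_mul, pow_zero, mul_one,
    ← Finset.range_eq_Ico, Finset.prod_mul_distrib] at hshanks
  · simp only [CharTwo.sub_eq_add] at hshanks
    have hU : (∏ j ∈ Finset.range n, u j) * P = 1 := by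
      rw [hP, ← Finset.prod_mul_distrib]
      exact Finset.prod_eq_one fun j _ => hu j
    rw [← hshanks, hsq]
    linear_combination (E ^ 2 * P ^ 2) * hU + (P * E + 1) * hPE
  · intro s _
    rw [show (s + 1) * (2 * n + 1) = n + 1 + (s * (2 * n + 1) + n) by ring, pow_add, hq]
    simp

end FiniteGauss

section CharTwoSeries

open PowerSeries

instance charP_two_powerSeries : CharP (ZMod 2)⟦X⟧ 2 :=
  charP_of_injective_ringHom (f := C) C_injective 2

theorem sq_eq_expand_two (f : (ZMod 2)⟦X⟧) : f ^ 2 = expand 2 two_ne_zero f := by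
  have h := MvPowerSeries.map_frobenius_expand 2 two_ne_zero (f := f)
  rw [ZMod.frobenius_zmod] at h
  rw [← h]
  exact congrFun (congrArg DFunLike.coe MvPowerSeries.map_id) _

theorem coeff_sq (f : (ZMod 2)⟦X⟧) (d : ℕ) :
    coeff d (f ^ 2) = if 2 ∣ d then coeff (d / 2) f else 0 := by
  rw [sq_eq_expand_two, coeff_expand]

theorem coeff_pow_two_mul_self (f : (ZMod 2)⟦X⟧) {d : ℕ} (hd : d ≠ 0) :
    coeff d (f ^ (2 * d)) = 0 := by
  induction d using Nat.strong_induction_on with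
  | _ d ih =>
    rw [mul_comm, pow_mul, coeff_sq]
    split_ifs with h
    · obtain ⟨e, rfl⟩ := h
      rw [Nat.mul_div_cancel_left e two_pos]
      exact ih e (by omega) (by omega)
    · rfl

/-- The series `∑ X ^ (t (t + 1) / 2)` over `t ≥ 0`. -/
noncomputable def triangularSeries : (ZMod 2)⟦X⟧ :=
  open Classical in PowerSeries.mk fun d => if ∃ t, t * (t + 1) / 2 = d then 1 else 0

/-- The series `∑ X ^ (n ^ 2)` over `n ≥ 1`. -/
noncomputable def squareSeries : (ZMod 2)⟦X⟧ :=
  open Classical in PowerSeries.mk fun d => if ∃ n, n ≠ 0 ∧ n ^ 2 = d then 1 else 0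

/-- The partial product of `∏ (1 + X ^ j)` over odd `j`. -/
noncomputable def oddProd (n : ℕ) : (ZMod 2)⟦X⟧ :=
  ∏ j ∈ Finset.range n, (1 + X ^ (2 * j + 1))

theorem triangular_injective : Function.Injective fun t : ℕ => t * (t + 1) / 2 := by
  refine StrictMono.injective (strictMono_nat_of_lt_succ fun t => ?_)
  rw [show (t + 1) * (t + 1 + 1) = t * (t + 1) + 2 * (t + 1) by ring,
    Nat.add_mul_div_left _ _ two_pos]
  omega

theorem two_mul_triangular (t : ℕ) : 2 * (t * (t + 1) / 2) = t * (t + 1) :=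
  Nat.mul_div_cancel' (Nat.even_mul_succ_self t).two_dvd

theorem X_pow_dvd_triangularSeries_sub (n : ℕ) :
    (X : (ZMod 2)⟦X⟧) ^ (n + 1) ∣
      triangularSeries - ∑ t ∈ Finset.range (2 * n + 1), X ^ (t * (t + 1) / 2) := by
  rw [X_pow_dvd_iff]
  intro m hm
  rw [map_sub, map_sum, sub_eq_zero, triangularSeries, coeff_mk]
  simp only [coeff_X_pow]
  split_ifs with h
  · obtain ⟨t, rfl⟩ := h
    rw [Finset.sum_eq_single t, if_pos rfl]
    · intro s _ hs
      exact if_neg fun h => hs (triangular_injective h.symm)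
    · intro ht
      have := two_mul_triangular t
      simp only [Finset.mem_range, not_lt] at ht
      nlinarith
  · exact (Finset.sum_eq_zero fun t _ => if_neg fun ht => h ⟨t, ht.symm⟩).symm

theorem X_pow_dvd_triangularSeries_mul_sub_one (n : ℕ) :
    (X : (ZMod 2)⟦X⟧) ^ (n + 1) ∣ triangularSeries * oddProd n ^ 3 - 1 := by
  set I := Ideal.span {(X : (ZMod 2)⟦X⟧) ^ (n + 1)} with hI
  have hmk : ∀ a b : (ZMod 2)⟦X⟧, Ideal.Quotient.mk I a = Ideal.Quotient.mk I b ↔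
      X ^ (n + 1) ∣ a - b := fun a b => by
    rw [Ideal.Quotient.eq, hI, Ideal.mem_span_singleton]
  rw [← hmk]
  rcases subsingleton_or_nontrivial ((ZMod 2)⟦X⟧ ⧸ I) with _ | _
  · exact Subsingleton.elim _ _
  have : CharP ((ZMod 2)⟦X⟧ ⧸ I) 2 :=
    charP_of_injective_ringHom (f := (Ideal.Quotient.mk I).comp C) (RingHom.injective _) 2
  have hX : Ideal.Quotient.mk I X ^ (n + 1) = 0 := by
    rw [← map_pow, Ideal.Quotient.eq_zero_iff_mem, hI]
    exact Ideal.mem_span_singleton_self _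
  have h := triangular_sum_mul_prod_odd_cube (Ideal.Quotient.mk I X) n hX
  rw [map_mul, (hmk _ _).2 (X_pow_dvd_triangularSeries_sub n), oddProd]
  simpa using h

theorem squareSeries_eq :
    squareSeries = X * triangularSeries ^ 8 + squareSeries ^ 4 := by
  ext d
  rw [show (8 : ℕ) = 2 * 2 * 2 by rfl, show (4 : ℕ) = 2 * 2 by rfl, pow_mul, pow_mul, pow_mul,
    map_add]
  classical
  have htri : (∃ n, n ≠ 0 ∧ n ^ 2 = d) ∧ d % 4 ≠ 0 ↔ ∃ t, t * (t + 1) / 2 * 8 + 1 = d := by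
    constructor
    · rintro ⟨⟨n, -, rfl⟩, hd⟩
      rcases Nat.even_or_odd' n with ⟨t, rfl | rfl⟩
      · exact absurd (by ring_nf; omega) hd
      · exact ⟨t, by
          linarith [two_mul_triangular t, show (2 * t + 1) ^ 2 = 4 * (t * (t + 1)) + 1 by ring]⟩
    · rintro ⟨t, rfl⟩
      exact ⟨⟨2 * t + 1, by omega, by
        linarith [two_mul_triangular t, show (2 * t + 1) ^ 2 = 4 * (t * (t + 1)) + 1 by ring]⟩,
        by omega⟩
  have hsquare : (∃ n, n ≠ 0 ∧ n ^ 2 = d) ∧ d % 4 = 0 ↔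
      d % 4 = 0 ∧ ∃ n, n ≠ 0 ∧ n ^ 2 = d / 4 := by
    rw [and_comm]
    refine and_congr_right fun hd => ⟨?_, ?_⟩
    · rintro ⟨n, hn, rfl⟩
      rcases Nat.even_or_odd' n with ⟨t, rfl | rfl⟩
      · exact ⟨t, by omega, by rw [mul_pow]; omega⟩
      · ring_nf at hd; omega
    · rintro ⟨n, hn, h⟩
      exact ⟨2 * n, by omega, by rw [mul_pow]; omega⟩
  have hleft : coeff d (X * ((triangularSeries ^ 2) ^ 2) ^ 2) =
      if ∃ t, t * (t + 1) / 2 * 8 + 1 = d then 1 else 0 := by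
    rcases d with _ | d
    · simp
    · rw [coeff_succ_X_mul, coeff_sq, coeff_sq, coeff_sq, triangularSeries, coeff_mk]
      by_cases h : 8 ∣ d
      · obtain ⟨e, rfl⟩ := h
        rw [if_pos (by omega), if_pos (by omega), if_pos (by omega)]
        have h : (∃ t, t * (t + 1) / 2 = 8 * e / 2 / 2 / 2) ↔
            ∃ t, t * (t + 1) / 2 * 8 + 1 = 8 * e + 1 :=
          exists_congr fun t => by omega
        simp only [h]
      · have h' : ¬ ∃ t, t * (t + 1) / 2 * 8 + 1 = d + 1 :=
          fun ⟨t, ht⟩ => h ⟨t * (t + 1) / 2, by linarith⟩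
        rw [if_neg h']
        split_ifs <;> first | rfl | omega
  have hright : coeff d ((squareSeries ^ 2) ^ 2) =
      if d % 4 = 0 ∧ ∃ n, n ≠ 0 ∧ n ^ 2 = d / 4 then 1 else 0 := by
    rw [coeff_sq, coeff_sq, squareSeries, coeff_mk, Nat.div_div_eq_div_mul]
    by_cases h : d % 4 = 0
    · rw [if_pos (by omega), if_pos (by omega)]
      simp [h]
    · rw [if_neg (fun h' : _ ∧ _ => h h'.1)]
      split_ifs <;> first | rfl | omega
  rw [hleft, hright, squareSeries, coeff_mk]
  simp only [← hsquare, ← htri]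
  by_cases h1 : ∃ n, n ≠ 0 ∧ n ^ 2 = d <;> by_cases h2 : d % 4 = 0 <;> simp [h1, h2]

theorem squareSeries_eq_sum (K : ℕ) :
    squareSeries = ∑ k ∈ Finset.range K, (X * triangularSeries ^ 8) ^ 4 ^ k +
      squareSeries ^ 4 ^ K := by
  induction K with
  | zero => simp
  | succ K ih =>
    have h : squareSeries ^ 4 ^ K =
        (X * triangularSeries ^ 8) ^ 4 ^ K + squareSeries ^ 4 ^ (K + 1) := by
      conv_lhs => rw [squareSeries_eq]
      rw [show (4 : ℕ) ^ K = 2 ^ (2 * K) by rw [pow_mul]; rfl, add_pow_char_pow,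
        ← pow_mul squareSeries, pow_succ' 4, pow_mul 2 2 K]
      rfl
    rw [Finset.sum_range_succ, add_assoc, ← h, ← ih]

theorem coeff_pow_mul_oddProd_pow {w m N : ℕ} (hN : w ≤ N) :
    coeff w ((X * triangularSeries ^ 8) ^ m * oddProd N ^ (24 * w)) = if m = w then 1 else 0 := by
  rw [mul_pow, mul_assoc, coeff_X_pow_mul']
  rcases lt_trichotomy m w with h | rfl | h
  · rw [if_pos h.le, if_neg h.ne]
    obtain ⟨d, rfl⟩ := Nat.exists_eq_add_of_lt h
    rw [show m + d + 1 - m = d + 1 by omega]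
    have hdvd : (X : (ZMod 2)⟦X⟧) ^ (N + 1) ∣
        (triangularSeries ^ 8) ^ m * oddProd N ^ (24 * (m + d + 1)) -
          (oddProd N ^ 12) ^ (2 * (d + 1)) := by
      have := ((X_pow_dvd_triangularSeries_mul_sub_one N).trans
        (sub_one_dvd_pow_sub_one _ (8 * m))).mul_right ((oddProd N ^ 12) ^ (2 * (d + 1)))
      convert this using 1
      ring
    rw [X_pow_dvd_iff] at hdvd
    have := hdvd (d + 1) (by omega)
    rwa [map_sub, coeff_pow_two_mul_self _ (by omega), sub_zero] at this
  · rw [if_pos le_rfl, if_pos rfl, Nat.sub_self]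
    have hdvd : (X : (ZMod 2)⟦X⟧) ^ (N + 1) ∣
        (triangularSeries ^ 8) ^ m * oddProd N ^ (24 * m) - 1 := by
      have := (X_pow_dvd_triangularSeries_mul_sub_one N).trans
        (sub_one_dvd_pow_sub_one _ (8 * m))
      convert this using 1
      ring
    rw [X_pow_dvd_iff] at hdvd
    have := hdvd 0 (by omega)
    rwa [map_sub, coeff_zero_one, sub_eq_zero] at this
  · rw [if_neg (by omega), if_neg h.ne']

open Classical in
theorem coeff_squareSeries_mul_oddProd_pow {w N : ℕ} (hN : w ≤ N) :
    coeff w (squareSeries * oddProd N ^ (24 * w)) =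
      if ∃ k, 4 ^ k = w then 1 else 0 := by
  have hw : w < 4 ^ w := Nat.lt_pow_self (by norm_num)
  have hX : X ∣ squareSeries := by
    rw [X_dvd_iff, ← coeff_zero_eq_constantCoeff, squareSeries, coeff_mk, if_neg]
    rintro ⟨n, hn, h⟩
    exact hn (pow_eq_zero_iff two_ne_zero |>.1 h)
  rw [squareSeries_eq_sum w, add_mul, map_add, Finset.sum_mul, map_sum,
    X_pow_dvd_iff.1 ((pow_dvd_pow_of_dvd hX (4 ^ w)).mul_right _) w hw, add_zero]
  simp only [coeff_pow_mul_oddProd_pow hN]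
  split_ifs with h
  · obtain ⟨k, rfl⟩ := h
    rw [Finset.sum_eq_single k, if_pos rfl]
    · intro b _ hb
      exact if_neg fun h => hb (Nat.pow_right_injective (by norm_num) h)
    · intro hk
      exact absurd (Finset.mem_range.2 (Nat.lt_pow_self (by norm_num))) hk
  · exact Finset.sum_eq_zero fun k _ => if_neg fun hk => h ⟨k, hk⟩

end CharTwoSeries

section Expansion

open PowerSeries

theorem coeff_one_add_X_pow_pow {R : Type*} [CommRing R] {i : ℕ} (hi : i ≠ 0) (M d : ℕ) :
    coeff d ((1 + X ^ i : R⟦X⟧) ^ M) = if i ∣ d then (M.choose (d / i) : R) else 0 := by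
  have h : (1 + X ^ i : R⟦X⟧) ^ M =
      expand i hi (((1 + Polynomial.X) ^ M : Polynomial R) : R⟦X⟧) := by simp
  rw [h, coeff_expand, Polynomial.coeff_coe, Polynomial.coeff_one_add_X_pow]

theorem oddProd_eq_prod_filter (N : ℕ) :
    oddProd N = ∏ j ∈ (Finset.range (2 * N)).filter Odd, (1 + X ^ j) := by
  have h : (Finset.range (2 * N)).filter Odd = (Finset.range N).image fun j => 2 * j + 1 := by
    ext j
    simp only [Finset.mem_filter, Finset.mem_range, Finset.mem_image]
    constructor
    · rintro ⟨hj, t, rfl⟩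
      exact ⟨t, by omega, rfl⟩
    · rintro ⟨t, ht, rfl⟩
      exact ⟨by omega, t, rfl⟩
  rw [h, Finset.prod_image fun a _ b _ h => by simpa using h, oddProd]

theorem Gsum_cast_eq_coeff {w n N : ℕ} (hn : n ^ 2 ≤ w) (hN : w ≤ N) :
    (Gsum (2 * w) n : ZMod 2) = coeff (w - n ^ 2) (oddProd N ^ (24 * w)) := by
  set S := (Finset.range (2 * N)).filter Odd with hS
  have hSpos : ∀ i ∈ S, i ≠ 0 := fun i hi h => by
    simp [hS, h] at hi
  set A := (Finset.finsuppAntidiag S (w - n ^ 2)).filter fun l => ∀ i ∈ S, i ∣ l i with hA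
  have hdeg : ∀ r : ℕ →₀ ℕ,
      2 * ((r.sum fun j k => j * k : ℕ) : ℤ) = ((2 * w : ℕ) : ℤ) - 2 * (n : ℤ) ^ 2 ↔
        (r.sum fun j k => j * k) = w - n ^ 2 := fun r => by
    zify [hn]
    constructor <;> intro h <;> linarith
  let e : (ℕ →₀ ℕ) → ℕ →₀ ℕ := fun r =>
    Finsupp.onFinset r.support (fun j => j * r j) fun j hj => by
      rw [Finsupp.mem_support_iff]; exact right_ne_zero_of_mul hj
  have he : ∀ r j, e r j = j * r j := fun r j => rfl
  have hsupp : ∀ r : ℕ →₀ ℕ, (∀ j ∈ r.support, Odd j) →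
      (r.sum fun j k => j * k) = w - n ^ 2 → r.support ⊆ S := by
    intro r hodd hr j hj
    have hle : j * r j ≤ r.sum fun j k => j * k :=
      Finset.single_le_sum (f := fun j => j * r j) (fun _ _ => Nat.zero_le _) hj
    have hpos := Nat.pos_of_ne_zero (Finsupp.mem_support_iff.1 hj)
    have hj0 := (hodd j hj).pos
    rw [hS, Finset.mem_filter, Finset.mem_range]
    exact ⟨by nlinarith [Nat.sub_le w (n ^ 2)], hodd j hj⟩
  have hbij : Set.BijOn e {r : ℕ →₀ ℕ | (∀ j ∈ r.support, Odd j) ∧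
      2 * ((r.sum fun j k => j * k : ℕ) : ℤ) = ((2 * w : ℕ) : ℤ) - 2 * (n : ℤ) ^ 2} A := by
    refine ⟨?_, ?_, ?_⟩
    · rintro r ⟨hodd, hr⟩
      rw [hdeg] at hr
      have hrS := hsupp r hodd hr
      rw [Finset.mem_coe, hA, Finset.mem_filter, Finset.mem_finsuppAntidiag]
      refine ⟨⟨?_, Finsupp.support_onFinset_subset.trans hrS⟩, fun i _ => ⟨r i, he r i⟩⟩
      rw [← hr, Finsupp.sum_of_support_subset r hrS _ fun i _ => mul_zero i]
      exact Finset.sum_congr rfl fun i _ => he r i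
    · rintro r ⟨hr, -⟩ r' ⟨hr', -⟩ h
      ext j
      by_cases hj : j = 0
      · subst hj
        rw [Finsupp.notMem_support_iff.1 fun h => by simpa using hr 0 h,
          Finsupp.notMem_support_iff.1 fun h => by simpa using hr' 0 h]
      · exact Nat.eq_of_mul_eq_mul_left (Nat.pos_of_ne_zero hj) (DFunLike.congr_fun h j)
    · intro l hl
      rw [Finset.mem_coe, hA, Finset.mem_filter, Finset.mem_finsuppAntidiag] at hl
      obtain ⟨⟨hsum, hlS⟩, hdvd⟩ := hl
      let r : ℕ →₀ ℕ := Finsupp.onFinset l.support (fun j => l j / j) fun j hj => by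
        rw [Finsupp.mem_support_iff]
        rintro h
        simp [h] at hj
      have hr : ∀ j, j * r j = l j := fun j => by
        by_cases hj : j ∈ S
        · exact Nat.mul_div_cancel' (hdvd j hj)
        · have h0 : l j = 0 := Finsupp.notMem_support_iff.1 fun h => hj (hlS h)
          change j * (l j / j) = l j
          simp [h0]
      have hrS : r.support ⊆ S := Finsupp.support_onFinset_subset.trans hlS
      refine ⟨r, ⟨fun j hj => (Finset.mem_filter.1 (hrS hj)).2, ?_⟩, Finsupp.ext hr⟩
      rw [hdeg, ← hsum, Finsupp.sum_of_support_subset r hrS _ fun i _ => mul_zero i]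
      exact Finset.sum_congr rfl fun i _ => hr i
  have hG : Gsum (2 * w) n = ∑ l ∈ A, ∏ j ∈ S, (24 * w).choose (l j / j) := by
    rw [Gsum, finsum_mem_eq_of_bijOn e hbij
      (g := fun l => ∏ j ∈ S, (24 * w).choose (l j / j)), finsum_mem_coe_finset]
    rintro r ⟨hodd, hr⟩
    rw [hdeg] at hr
    rw [show 12 * (2 * w) = 24 * w by ring]
    refine Finset.prod_subset_one_on_sdiff (hsupp r hodd hr) ?_ ?_
    · intro j hj
      have h0 := Finsupp.notMem_support_iff.1 (Finset.mem_sdiff.1 hj).2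
      simp [he, h0]
    · intro j hj
      rw [he, Nat.mul_div_cancel_left _ (hodd j hj).pos]
  rw [hG, oddProd_eq_prod_filter, ← Finset.prod_pow, coeff_prod, Nat.cast_sum, hA,
    Finset.sum_filter]
  refine Finset.sum_congr rfl fun l _ => ?_
  rw [Finset.prod_congr rfl fun i hi => coeff_one_add_X_pow_pow (hSpos i hi) (24 * w) (l i)]
  split_ifs with h
  · rw [Nat.cast_prod]
    exact Finset.prod_congr rfl fun i hi => (if_pos (h i hi)).symm
  · push Not at h
    obtain ⟨i, hi, hd⟩ := h
    exact (Finset.prod_eq_zero hi (if_neg hd)).symm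

end Expansion

open Classical in
theorem Fsum_cast_two_mul (w : ℕ) :
    (Fsum (2 * w) : ZMod 2) = if ∃ k, 4 ^ k = w then 1 else 0 := by
  rw [← coeff_squareSeries_mul_oddProd_pow (le_refl w), PowerSeries.coeff_mul,
    Finset.Nat.sum_antidiagonal_eq_sum_range_succ
      fun i j => PowerSeries.coeff i squareSeries * PowerSeries.coeff j (oddProd w ^ (24 * w))]
  have hset : {n : ℕ | 1 ≤ n ∧ 2 * n ^ 2 ≤ 2 * w} =
      ((Finset.range (w + 1)).filter fun n => n ≠ 0 ∧ n ^ 2 ≤ w : Finset ℕ) := by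
    ext n
    simp only [Set.mem_ofPred_eq, Finset.coe_filter, Finset.mem_range]
    constructor
    · rintro ⟨h1, h2⟩
      exact ⟨by nlinarith, by omega, by omega⟩
    · rintro ⟨-, h1, h2⟩
      exact ⟨by omega, by omega⟩
  rw [Fsum, hset, finsum_mem_coe_finset, Nat.cast_sum]
  simp only [squareSeries, PowerSeries.coeff_mk, ite_mul, one_mul, zero_mul]
  rw [← Finset.sum_filter]
  refine Finset.sum_nbij (fun n => n ^ 2) ?_ ?_ ?_ ?_
  · intro n hn
    simp only [Finset.mem_filter, Finset.mem_range] at hn ⊢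
    exact ⟨by omega, n, hn.2.1, rfl⟩
  · intro a _ b _ h
    exact Nat.pow_left_injective two_ne_zero h
  · intro d hd
    simp only [Finset.coe_filter, Finset.mem_range, Set.mem_ofPred_eq, Set.mem_image] at hd ⊢
    obtain ⟨hd, n, hn, rfl⟩ := hd
    exact ⟨n, ⟨by nlinarith [Nat.pos_of_ne_zero hn], hn, by omega⟩, rfl⟩
  · intro n hn
    exact Gsum_cast_eq_coeff (Finset.mem_filter.1 hn).2.2 le_rfl

theorem Gsum_eq_zero_of_odd {v : ℕ} (hv : Odd v) (n : ℕ) : Gsum v n = 0 := by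
  rw [Gsum]
  refine finsum_mem_eq_zero_of_forall_eq_zero fun r hr => ?_
  obtain ⟨t, rfl⟩ := hv
  have := hr.2
  push_cast at this
  omega

/-- `F(v)` is odd if and only if `v = 2^β` for some odd `β`. -/
theorem Fsum_odd_iff (v : ℕ) (hv : 1 ≤ v) :
    Odd (Fsum v) ↔ ∃ β : ℕ, Odd β ∧ v = 2 ^ β := by
  rcases Nat.even_or_odd' v with ⟨w, rfl | rfl⟩
  · rw [← ZMod.natCast_eq_one_iff_odd, Fsum_cast_two_mul]
    have h : (∃ k, 4 ^ k = w) ↔ ∃ β : ℕ, Odd β ∧ 2 * w = 2 ^ β := by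
      constructor
      · rintro ⟨k, rfl⟩
        exact ⟨2 * k + 1, ⟨k, rfl⟩, by rw [pow_succ', pow_mul]; norm_num⟩
      · rintro ⟨_, ⟨k, rfl⟩, h⟩
        refine ⟨k, ?_⟩
        rw [pow_succ', pow_mul] at h
        exact (Nat.eq_of_mul_eq_mul_left two_pos h).symm
    simp [h]
  · have h0 : Fsum (2 * w + 1) = 0 :=
      finsum_mem_eq_zero_of_forall_eq_zero fun n _ => Gsum_eq_zero_of_odd ⟨w, rfl⟩ n
    rw [h0]
    refine iff_of_false (by simp) ?_
    rintro ⟨_, ⟨k, rfl⟩, h⟩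
    rw [pow_succ'] at h
    omega
end

section
/- Let v ∈ ℕ with v ≥ 1, write v = 2^β·w with w odd and β ∈ ℕ∪{0}, and let n ≥ 1 be an integer with 2n² ≤ v. If G(v, n) = Σ_r ∏_j binom(12v, r_j) is odd — the sum being over all finitely supported functions r from the odd positive integers to ℕ∪{0} with 2·Σ_j j·r_j = v − 2n² — then β is odd, there exists an odd m ∈ ℕ with n = 2^{(β−1)/2}·m, and w ≡ 1 (mod 8). -/
theorem Nat.pow_dvd_of_odd_choose {a c r : ℕ} (h : Odd ((2 ^ a * c).choose r)) : 2 ^ a ∣ r := by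
  rcases r with _ | r
  · exact dvd_zero _
  rcases hN : 2 ^ a * c with _ | N
  · simp [hN] at h
  have hmul : 2 ^ a ∣ (2 ^ a * c).choose (r + 1) * (r + 1) := by
    rw [hN, ← Nat.add_one_mul_choose_eq, ← hN]
    exact Dvd.dvd.mul_right (dvd_mul_right _ _) _
  exact ((Nat.coprime_two_left.2 h).pow_left a).dvd_of_dvd_mul_left hmul

theorem Nat.two_pow_mul_odd_inj {a b x y : ℕ} (hx : Odd x) (hy : Odd y)
    (h : 2 ^ a * x = 2 ^ b * y) : a = b ∧ x = y := by
  have le_of_eq_mul {a b x y : ℕ} (hy : Odd y) (h : 2 ^ a * x = 2 ^ b * y) : a ≤ b :=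
    (Nat.pow_dvd_pow_iff_le_right (by norm_num : 1 < 2)).1 <|
      ((Nat.coprime_two_left.2 hy).pow_left a).dvd_of_dvd_mul_right (h ▸ dvd_mul_right _ _)
  obtain rfl : a = b := le_antisymm (le_of_eq_mul hy h) (le_of_eq_mul hx h.symm)
  exact ⟨rfl, Nat.eq_of_mul_eq_mul_left (by positivity) h⟩

/-- A nonzero term of `Gsum v n` modulo `2` only involves multiplicities divisible by every power
of `2` dividing `12 * v`. -/
theorem exists_eq_of_odd_Gsum {v n a c : ℕ} (ha : 12 * v = 2 ^ a * c) (hG : Odd (Gsum v n)) :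
    ∃ k : ℕ, 2 * n ^ 2 + 2 * (2 ^ a * k) = v := by
  by_contra hne
  refine Nat.not_even_iff_odd.2 hG (finsum_mem_induction (Even ·) Even.zero
    (fun _ _ => Even.add) ?_)
  rintro r ⟨-, hr⟩
  by_contra hodd
  rw [Nat.not_even_iff_odd] at hodd
  have hdvd : 2 ^ a ∣ r.sum fun j k => j * k :=
    Finset.dvd_sum fun j hj => Dvd.dvd.mul_left
      (Nat.pow_dvd_of_odd_choose (c := c)
        (ha ▸ hodd.of_dvd_nat (Finset.dvd_prod_of_mem _ hj))) _
  obtain ⟨k, hk⟩ := hdvd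
  refine hne ⟨k, ?_⟩
  rw [hk] at hr
  zify
  push_cast at hr
  linarith

/-- If `v = 2^β·w ≥ 1` with `w` odd, `n ≥ 1`, `2n² ≤ v`, and `G(v,n)` is odd, then `β` is odd,
`n = 2^{(β−1)/2}·m` for some odd `m`, and `w ≡ 1 (mod 8)`. -/
theorem Gsum_odd_consequences (v β w n : ℕ) (hv : 1 ≤ v) (hw : Odd w)
    (hβ : v = 2 ^ β * w) (hn : 1 ≤ n) (h2 : 2 * n ^ 2 ≤ v) (hG : Odd (Gsum v n)) :
    Odd β ∧ (∃ m : ℕ, Odd m ∧ n = 2 ^ ((β - 1) / 2) * m) ∧ w % 8 = 1 := by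
  obtain ⟨k, hk⟩ := exists_eq_of_odd_Gsum (a := β + 2) (c := 3 * w) (by rw [hβ]; ring) hG
  rw [hβ] at hk
  rcases β with _ | b
  · rw [pow_zero, one_mul] at hk
    obtain ⟨t, rfl⟩ := hw
    omega
  have hsq : n ^ 2 + 2 ^ b * (8 * k) = 2 ^ b * w := by
    have : 2 * (n ^ 2 + 2 ^ b * (8 * k)) = 2 * (2 ^ b * w) := by
      linear_combination hk
    omega
  have hlt : 8 * k < w := by
    refine lt_of_mul_lt_mul_left (a := 2 ^ b) ?_ (Nat.zero_le _)
    have : 0 < n ^ 2 := by positivity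
    omega
  obtain ⟨c, rfl⟩ := Nat.exists_eq_add_of_lt hlt
  obtain ⟨e, m, hm, rfl⟩ := Nat.exists_eq_two_pow_mul_odd (n := n) (by omega)
  have hc : Odd (c + 1) := by
    obtain ⟨t, ht⟩ := hw
    exact ⟨t - 4 * k, by omega⟩
  obtain ⟨rfl, hmc⟩ := Nat.two_pow_mul_odd_inj (a := 2 * e) (b := b) (hm.pow (n := 2)) hc
    (by linear_combination hsq)
  refine ⟨⟨e, rfl⟩, ⟨m, hm, by simp⟩, ?_⟩
  have hmod : m ^ 2 % 8 = 1 := by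
    have : m % 8 = 1 ∨ m % 8 = 3 ∨ m % 8 = 5 ∨ m % 8 = 7 := by
      obtain ⟨t, rfl⟩ := hm
      omega
    rcases this with h | h | h | h <;> simp [Nat.pow_mod, h]
  omega
end

section
/- For every n ∈ ℕ, the number of partitions of n into distinct odd parts is congruent modulo 2 to the total number of partitions of n. (Equivalently, the coefficient of q^n in ∏_{j odd}(1+q^j) is congruent mod 2 to the coefficient of q^n in ∏_{j≥1}(1−q^j)^{-1}.) -/
open PowerSeries PowerSeries.WithPiTopology Finset

/-- The generating function of partitions into distinct parts satisfying `p` is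
`∏ (1 + X ^ i)` over all positive `i` satisfying `p`. -/
theorem hasProd_powerSeriesMk_card_restricted_distincts (R : Type*) [CommSemiring R]
    [TopologicalSpace R] [T2Space R] (p : ℕ → Prop) [DecidablePred p] :
    HasProd (fun i ↦ if p (i + 1) then 1 + X ^ (i + 1) else 1)
      (PowerSeries.mk fun n ↦
        (#{x ∈ Nat.Partition.restricted n p | x ∈ Nat.Partition.distincts n} : R)) := by
  convert! Nat.Partition.hasProd_genFun
    (fun i c ↦ if p i ∧ c < 2 then (1 : R) else 0) using 1
  · ext1 i
    rw [tsum_eq_single 0 fun j hj ↦ by simp [hj]]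
    by_cases h : p (i + 1) <;> simp [h]
  · simp_rw [← Nat.Partition.countRestricted_two, Nat.Partition.genFun,
      Nat.Partition.countRestricted, Nat.Partition.restricted, mem_filter_univ, filter_filter,
      card_filter, Finsupp.prod, prod_boole]
    simp [forall_and]

/-- In characteristic two, the generating function of partitions into parts satisfying `p` is
inverse to that of partitions into distinct parts satisfying `p`. -/
theorem powerSeriesMk_card_restricted_distincts_mul_restricted (R : Type*) [CommRing R]
    [CharP R 2] (p : ℕ → Prop) [DecidablePred p] :
    (PowerSeries.mk fun n ↦
        (#{x ∈ Nat.Partition.restricted n p | x ∈ Nat.Partition.distincts n} : R)) *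
      (PowerSeries.mk fun n ↦ (#(Nat.Partition.restricted n p) : R)) = 1 := by
  let _ : TopologicalSpace R := ⊥
  have _ : DiscreteTopology R := ⟨rfl⟩
  refine ((hasProd_powerSeriesMk_card_restricted_distincts R p).mul
    (Nat.Partition.hasProd_powerSeriesMk_card_restricted R p)).unique ?_
  convert! hasProd_one (α := R⟦X⟧) (β := ℕ) using 1
  ext1 i
  split_ifs
  · have h : (1 : R⟦X⟧) + X ^ (i + 1) = 1 - X ^ (i + 1) := by
      have : (2 : R⟦X⟧) = 0 := by
        rw [← map_ofNat (PowerSeries.C (R := R)) 2, CharTwo.two_eq_zero, map_zero]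
      linear_combination X ^ (i + 1) * this
    simp_rw [h, pow_mul]
    rw [mul_comm, tsum_pow_mul_one_sub_of_constantCoeff_eq_zero (by simp)]
  · simp

/-- The number of partitions of `n` into distinct odd parts is congruent mod 2 to the total
number of partitions of `n`. -/
theorem card_odd_distinct_partitions_mod_two (n : ℕ) :
    ((Nat.Partition.odds n).filter (fun p => p ∈ Nat.Partition.distincts n)).card % 2 =
      Fintype.card (Nat.Partition n) % 2 := by
  have hodd := powerSeriesMk_card_restricted_distincts_mul_restricted (ZMod 2) (¬ Even ·)
  have hall := powerSeriesMk_card_restricted_distincts_mul_restricted (ZMod 2) fun _ ↦ True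
  have euler : (PowerSeries.mk fun n ↦ (#(Nat.Partition.restricted n (¬ Even ·)) : ZMod 2)) =
      PowerSeries.mk fun n ↦ (#{x ∈ Nat.Partition.restricted n fun _ ↦ True |
        x ∈ Nat.Partition.distincts n} : ZMod 2) := by
    ext m
    simpa [Nat.Partition.restricted, Nat.Partition.odds] using
      congrArg (Nat.cast (R := ZMod 2)) (Nat.Partition.card_odds_eq_card_distincts m)
  rw [euler] at hodd
  have h := congrArg (PowerSeries.coeff n) (left_inv_eq_right_inv hodd hall)
  simp only [coeff_mk] at h
  simpa [Nat.Partition.restricted, Nat.Partition.odds, Nat.ModEq] using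
    (ZMod.natCast_eq_natCast_iff _ _ 2).mp h
end

section
/- Let N ∈ ℕ and let m ∈ ℕ with m ≥ N. Then the coefficient of X^N in the integer polynomial (∏_{j=1}^{m} (1 − X^j))³ ∈ ℤ[X] is odd if and only if N is a triangular number, i.e., if and only if there exists t ∈ ℕ with 2N = t(t+1). (This is the mod-2 statement ∏_{j≥1}(1−q^j)³ ≡ Σ_{t≥0} q^{t(t+1)/2} mod 2; the truncation at m ≥ N does not affect the coefficient of X^N.) -/
open Finset Polynomial

/-- The telescoping sum behind Shanks's finite version of Gauss's identity for triangular
numbers, with denominators cleared. -/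
theorem sum_range_shanks_telescope {R : Type*} [CommRing R] (q : R) (n k : ℕ) (hk : k ≤ n) :
    ∑ s ∈ range (k + 1), (∏ j ∈ range s, (1 - q ^ (2 * j + 1))) *
        (∏ j ∈ Ico s n, (1 - q ^ (2 * j + 2))) * q ^ (s * (2 * n + 1)) *
        ((1 - q ^ (2 * n + 2)) * q ^ (2 * s) - (1 - q ^ (2 * n + 1))) =
      (∏ j ∈ range (k + 1), (1 - q ^ (2 * j + 1))) *
        (∏ j ∈ Ico k n, (1 - q ^ (2 * j + 2))) * q ^ ((k + 1) * (2 * n + 1)) := by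
  induction k with
  | zero => simp; ring
  | succ k ih =>
    rw [sum_range_succ, ih (by omega), prod_range_succ _ (k + 1),
      prod_eq_prod_Ico_succ_bot (show k < n by omega)]
    ring

/-- Shanks's finite version of Gauss's identity for triangular numbers. -/
theorem sum_range_shanks {R : Type*} [CommRing R] (q : R) (n : ℕ) :
    ∑ s ∈ range (n + 1), (∏ j ∈ range s, (1 - q ^ (2 * j + 1))) *
        (∏ j ∈ Ico s n, (1 - q ^ (2 * j + 2))) * q ^ (s * (2 * n + 1)) =
      (∏ j ∈ range n, (1 - q ^ (2 * j + 1))) *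
        ∑ s ∈ range (2 * n + 1), q ^ (s * (s + 1) / 2) := by
  induction n with
  | zero => simp
  | succ n ih =>
    have hodd : (2 * n + 1) * (2 * n + 1 + 1) / 2 = (n + 1) * (2 * n + 1) :=
      Nat.div_eq_of_eq_mul_left two_pos (by ring)
    have heven : (2 * n + 2) * (2 * n + 2 + 1) / 2 = (n + 1) * (2 * n + 3) :=
      Nat.div_eq_of_eq_mul_left two_pos (by ring)
    have htel := sum_range_shanks_telescope q n n le_rfl
    have hsplit : ∑ s ∈ range (n + 1), (∏ j ∈ range s, (1 - q ^ (2 * j + 1))) *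
        (∏ j ∈ Ico s (n + 1), (1 - q ^ (2 * j + 2))) * q ^ (s * (2 * (n + 1) + 1)) =
        ∑ s ∈ range (n + 1), (∏ j ∈ range s, (1 - q ^ (2 * j + 1))) *
          (∏ j ∈ Ico s n, (1 - q ^ (2 * j + 2))) * q ^ (s * (2 * n + 1)) *
          ((1 - q ^ (2 * n + 2)) * q ^ (2 * s) - (1 - q ^ (2 * n + 1))) +
        (1 - q ^ (2 * n + 1)) * ∑ s ∈ range (n + 1), (∏ j ∈ range s, (1 - q ^ (2 * j + 1))) *
          (∏ j ∈ Ico s n, (1 - q ^ (2 * j + 2))) * q ^ (s * (2 * n + 1)) := by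
      rw [mul_sum, ← sum_add_distrib]
      refine sum_congr rfl fun s hs => ?_
      rw [prod_Ico_succ_top (by simpa [Nat.lt_succ_iff] using hs)]
      ring
    rw [sum_range_succ, hsplit, htel, ih, show 2 * (n + 1) + 1 = 2 * n + 1 + 1 + 1 by ring,
      sum_range_succ _ (2 * n + 1 + 1), sum_range_succ _ (2 * n + 1), hodd, heven,
      prod_range_succ]
    simp only [Ico_self, prod_empty]
    ring

theorem prod_odd_mul_prod_even {R : Type*} [CommRing R] (q : R) (n : ℕ) :
    (∏ j ∈ range n, (1 - q ^ (2 * j + 1))) * ∏ j ∈ range n, (1 - q ^ (2 * j + 2)) =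
      ∏ j ∈ range (2 * n), (1 - q ^ (j + 1)) := by
  induction n with
  | zero => simp
  | succ n ih =>
    rw [prod_range_succ, prod_range_succ, show 2 * (n + 1) = 2 * n + 1 + 1 by ring,
      prod_range_succ _ (2 * n + 1), prod_range_succ _ (2 * n), ← ih]
    ring

/-- `∏ (1 - q ^ j) ^ 3 = ∑ q ^ (s (s + 1) / 2)` in characteristic two, for nilpotent `q`. -/
theorem prod_one_sub_pow_cubed_of_two_eq_zero {R : Type*} [CommRing R] (h2 : (2 : R) = 0) (q : R)
    (n : ℕ) (hq : q ^ (n + 1) = 0) :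
    (∏ j ∈ range n, (1 - q ^ (j + 1))) ^ 3 =
      ∑ s ∈ range (2 * n + 1), q ^ (s * (s + 1) / 2) := by
  have hzero {k : ℕ} (hk : n + 1 ≤ k) : q ^ k = 0 := pow_eq_zero_of_le hk hq
  have heven : ∏ j ∈ range n, (1 - q ^ (2 * j + 2)) = (∏ j ∈ range n, (1 - q ^ (j + 1))) ^ 2 := by
    rw [← prod_pow]
    refine prod_congr rfl fun j _ => ?_
    linear_combination (q ^ (j + 1) - q ^ (2 * j + 2)) * h2
  have htrunc : ∏ j ∈ range (2 * n), (1 - q ^ (j + 1)) = ∏ j ∈ range n, (1 - q ^ (j + 1)) := by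
    rw [two_mul, prod_range_add]
    simp [hzero (show n + 1 ≤ n + _ + 1 by omega)]
  have hunit : IsUnit (∏ j ∈ range n, (1 - q ^ (j + 1))) :=
    IsUnit.prod_iff.2 fun j _ => IsNilpotent.isUnit_one_sub
      (IsNilpotent.pow_of_pos ⟨n + 1, hq⟩ j.succ_ne_zero)
  have hinv : (∏ j ∈ range n, (1 - q ^ (2 * j + 1))) * ∏ j ∈ range n, (1 - q ^ (j + 1)) = 1 := by
    refine hunit.mul_right_cancel ?_
    rw [one_mul, mul_assoc, ← sq, ← heven, prod_odd_mul_prod_even, htrunc]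
  have hgauss := sum_range_shanks q n
  rw [sum_range_succ', sum_eq_zero fun s _ => by
    rw [hzero (show n + 1 ≤ (s + 1) * (2 * n + 1) by nlinarith), mul_zero]] at hgauss
  simp only [range_zero, prod_empty, zero_mul, pow_zero, mul_one, one_mul, zero_add,
    ← range_eq_Ico, heven] at hgauss
  linear_combination (∏ j ∈ range n, (1 - q ^ (j + 1))) * hgauss +
    (∑ s ∈ range (2 * n + 1), q ^ (s * (s + 1) / 2)) * hinv

theorem coeff_prod_one_sub_X_pow_cubed_zmod_two (N m : ℕ) (h : N ≤ m) :
    ((∏ j ∈ range m, (1 - (X : (ZMod 2)[X]) ^ (j + 1))) ^ 3).coeff N =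
      (∑ s ∈ range (2 * m + 1), (X : (ZMod 2)[X]) ^ (s * (s + 1) / 2)).coeff N := by
  let I := Ideal.span {(X : (ZMod 2)[X]) ^ (m + 1)}
  have htwo : (2 : (ZMod 2)[X] ⧸ I) = 0 :=
    (map_ofNat (Ideal.Quotient.mk I) 2).symm.trans
      ((congrArg _ CharTwo.two_eq_zero).trans (map_zero _))
  have hX : Ideal.Quotient.mk I X ^ (m + 1) = 0 := by
    rw [← map_pow]
    exact Ideal.Quotient.eq_zero_iff_mem.2 (Ideal.mem_span_singleton_self _)
  have hmk := prod_one_sub_pow_cubed_of_two_eq_zero htwo (Ideal.Quotient.mk I X) m hX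
  have hmem := Ideal.Quotient.eq.1 (show Ideal.Quotient.mk I
      ((∏ j ∈ range m, (1 - X ^ (j + 1))) ^ 3) =
      Ideal.Quotient.mk I (∑ s ∈ range (2 * m + 1), X ^ (s * (s + 1) / 2)) by simpa using hmk)
  rw [Ideal.mem_span_singleton, X_pow_dvd_iff] at hmem
  simpa [sub_eq_zero] using hmem N (by omega)

theorem coeff_sum_X_pow_triangular {R : Type*} [Semiring R] [Nontrivial R] (N k : ℕ)
    (h : 2 * N ≤ k) :
    (∑ s ∈ range (k + 1), (X : R[X]) ^ (s * (s + 1) / 2)).coeff N ≠ 0 ↔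
      ∃ t : ℕ, 2 * N = t * (t + 1) := by
  have hiff (s : ℕ) : N = s * (s + 1) / 2 ↔ 2 * N = s * (s + 1) := by
    have := Nat.even_mul_succ_self s
    grind
  simp only [finsetSum_coeff, coeff_X_pow, hiff]
  constructor
  · intro hne
    obtain ⟨t, -, ht⟩ := exists_ne_zero_of_sum_ne_zero hne
    exact ⟨t, by by_contra hc; simp [hc] at ht⟩
  · rintro ⟨t, ht⟩
    rw [sum_eq_single_of_mem t (mem_range.2 (by nlinarith)), if_pos ht]
    · exact one_ne_zero
    · intro s _ hst
      refine if_neg fun hs => hst ?_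
      nlinarith

/-- For `m ≥ N`, the coefficient of `X^N` in `(∏_{j=1}^m (1 − X^j))³ ∈ ℤ[X]` is odd if and
only if `N` is a triangular number. -/
theorem coeff_eta_cubed_odd_iff (N m : ℕ) (h : N ≤ m) :
    Odd (((∏ j ∈ Finset.Icc 1 m, ((1 : Polynomial ℤ) - Polynomial.X ^ j)) ^ 3).coeff N) ↔
      ∃ t : ℕ, 2 * N = t * (t + 1) := by
  have hcast : (((∏ j ∈ Icc 1 m, ((1 : ℤ[X]) - X ^ j)) ^ 3).coeff N : ZMod 2) =
      ((∏ j ∈ range m, (1 - (X : (ZMod 2)[X]) ^ (j + 1))) ^ 3).coeff N := by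
    rw [← eq_intCast (Int.castRingHom (ZMod 2)), ← coeff_map, range_eq_Ico,
      prod_Ico_add' (fun j => 1 - (X : (ZMod 2)[X]) ^ j), zero_add,
      ← Ico_succ_right_eq_Icc]
    simp [Polynomial.map_prod]
  rw [← coeff_sum_X_pow_triangular (R := ZMod 2) N (2 * m) (by omega),
    ← coeff_prod_one_sub_X_pow_cubed_zmod_two N m h, ← hcast, Ne,
    ZMod.intCast_zmod_eq_zero_iff_dvd _ 2, ← Int.not_even_iff_odd, even_iff_two_dvd]
  rfl
end
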